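/- If x, x′ ∈ [0,1) satisfy |D_n(x)| = |D_n(x′)| for every n ≥ 1, then f(x) = f(x′). -/

import Mathlib

/-- `phi x` is the distance from `x` to the nearest integer. -/
noncomputable def phi (x : ℝ) : ℝ := |x - round x|

/-- The signed Takagi function associated to the sign sequence `r`. -/
noncomputable def takagi (r : ℕ → ℝ) (x : ℝ) : ℝ :=
  ∑' n : ℕ, r n / 2 ^ n * phi (2 ^ n * x)

/-- `eps n x` is the `n`-th binary digit of `x ∈ [0,1)` (for `n ≥ 1`), using the
terminating expansion for dyadic rationals. -/
noncomputable def eps (n : ℕ) (x : ℝ) : ℕ := (⌊2 ^ n * x⌋ % 2).toNat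

/-- `Dfun r k x = ∑_{j=1}^k r_{j-1} (-1)^{ε_j(x)}`. -/
noncomputable def Dfun (r : ℕ → ℝ) (k : ℕ) (x : ℝ) : ℝ :=
  ∑ j ∈ Finset.Icc 1 k, r (j - 1) * (-1 : ℝ) ^ eps j x

/-- The digit `eps (n + 1) x` is `0` or `1` according to whether `2 ^ n * x` has fractional part
below `1 / 2`, and it controls `phi (2 ^ n * x)` and the next fractional part. -/
lemma eps_succ_cases (n : ℕ) (x : ℝ) :
    (eps (n + 1) x = 0 ∧ phi (2 ^ n * x) = Int.fract (2 ^ n * x) ∧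
      Int.fract (2 ^ (n + 1) * x) = 2 * Int.fract (2 ^ n * x)) ∨
    (eps (n + 1) x = 1 ∧ phi (2 ^ n * x) = 1 - Int.fract (2 ^ n * x) ∧
      Int.fract (2 ^ (n + 1) * x) = 2 * Int.fract (2 ^ n * x) - 1) := by
  have hpow : (2 : ℝ) ^ (n + 1) * x = 2 * (2 ^ n * x) := by ring
  unfold eps phi
  rw [hpow, abs_sub_round_eq_min]
  generalize 2 ^ n * x = z
  have h0 := Int.fract_nonneg z
  have h1 := Int.fract_lt_one z
  have hz := Int.floor_add_fract z
  rcases lt_or_ge (Int.fract z) (1 / 2) with hlt | hge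
  · have hf : ⌊2 * z⌋ = 2 * ⌊z⌋ := by
      rw [Int.floor_eq_iff]; push_cast; constructor <;> linarith
    refine Or.inl ⟨by rw [hf]; omega, min_eq_left (by linarith), ?_⟩
    rw [Int.fract, hf]; push_cast; linarith
  · have hf : ⌊2 * z⌋ = 2 * ⌊z⌋ + 1 := by
      rw [Int.floor_eq_iff]; push_cast; constructor <;> linarith
    refine Or.inr ⟨by rw [hf]; omega, min_eq_right (by linarith), ?_⟩
    rw [Int.fract, hf]; push_cast; linarith

lemma Dfun_succ (r : ℕ → ℝ) (n : ℕ) (x : ℝ) :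
    Dfun r (n + 1) x = Dfun r n x + r n * (-1) ^ eps (n + 1) x := by
  unfold Dfun
  rw [Finset.sum_Icc_succ_top (by omega), Nat.add_sub_cancel]

lemma abs_Dfun_le (r : ℕ → ℝ) (hr : ∀ n, r n = 1 ∨ r n = -1) (n : ℕ) (x : ℝ) :
    |Dfun r n x| ≤ n := by
  induction n with
  | zero => simp [Dfun]
  | succ n ih =>
    rw [Dfun_succ]
    refine (abs_add_le _ _).trans ?_
    have : |r n * (-1) ^ eps (n + 1) x| = 1 := by
      rcases hr n with h | h <;> simp [h]
    push_cast
    linarith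

lemma summable_takagi (r : ℕ → ℝ) (hr : ∀ n, r n = 1 ∨ r n = -1) (x : ℝ) :
    Summable fun n : ℕ => r n / 2 ^ n * phi (2 ^ n * x) := by
  refine Summable.of_norm_bounded (g := fun n : ℕ => (1 / 2 : ℝ) ^ n) summable_geometric_two ?_
  intro n
  have hphi : |phi (2 ^ n * x)| ≤ 1 := by
    unfold phi
    rw [abs_abs]
    exact (abs_sub_round _).trans (by norm_num)
  have habs : |r n| = 1 := by rcases hr n with h | h <;> simp [h]
  rw [Real.norm_eq_abs, abs_mul, abs_div, habs, abs_of_pos (by positivity : (0 : ℝ) < 2 ^ n),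
    one_div_pow]
  exact mul_le_of_le_one_right (by positivity) hphi

/-- The remainder left by Abel summation in a partial sum of the signed Takagi series. -/
noncomputable def takagiRemainder (r : ℕ → ℝ) (n : ℕ) (x : ℝ) : ℝ :=
  Dfun r n x * ((1 / 2 - Int.fract (2 ^ n * x)) / 2 ^ n)

lemma tendsto_takagiRemainder (r : ℕ → ℝ) (hr : ∀ n, r n = 1 ∨ r n = -1) (x : ℝ) :
    Filter.Tendsto (fun n => takagiRemainder r n x) Filter.atTop (nhds 0) := by
  refine squeeze_zero_norm (a := fun n : ℕ => (n : ℝ) * (1 / 2) ^ n) ?_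
    (tendsto_self_mul_const_pow_of_lt_one (by norm_num) (by norm_num))
  intro n
  have h0 := Int.fract_nonneg (2 ^ n * x)
  have h1 := Int.fract_lt_one (2 ^ n * x)
  rw [takagiRemainder, Real.norm_eq_abs, abs_mul, abs_div,
    abs_of_pos (by positivity : (0 : ℝ) < 2 ^ n), one_div_pow]
  have hu : |1 / 2 - Int.fract (2 ^ n * x)| ≤ 1 := by
    rw [abs_le]; constructor <;> linarith
  gcongr
  exact abs_Dfun_le r hr n x

/-- Abel summation: up to the remainder, the partial sums of the signed Takagi series depend only
on the squares of the `Dfun r k x`. -/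
lemma sum_takagi_add_takagiRemainder (r : ℕ → ℝ) (hr : ∀ n, r n = 1 ∨ r n = -1) (N : ℕ) (x : ℝ) :
    ∑ n ∈ Finset.range N, r n / 2 ^ n * phi (2 ^ n * x) + takagiRemainder r N x =
      ∑ n ∈ Finset.range N,
        r n / 2 ^ n * (1 / 2 - (Dfun r (n + 1) x ^ 2 + 1 - Dfun r n x ^ 2) / 8) := by
  induction N with
  | zero => simp [takagiRemainder, Dfun]
  | succ N ih =>
    rw [Finset.sum_range_succ, Finset.sum_range_succ, ← ih]
    unfold takagiRemainder
    rw [Dfun_succ]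
    generalize ∑ n ∈ Finset.range N, r n / 2 ^ n * phi (2 ^ n * x) = S
    rcases eps_succ_cases N x with ⟨he, hp, hf⟩ | ⟨he, hp, hf⟩ <;>
    · rw [he, hp, hf]
      rcases hr N with h | h <;>
      · rw [h, pow_succ]
        field_simp
        ring

/-- If `|D_n(x)| = |D_n(x')|` for every `n ≥ 1`, then `f(x) = f(x')`. -/
theorem takagi_eq_of_abs_D_eq (r : ℕ → ℝ) (hr : ∀ n, r n = 1 ∨ r n = -1)
    (x x' : ℝ) (hx : x ∈ Set.Ico (0 : ℝ) 1) (hx' : x' ∈ Set.Ico (0 : ℝ) 1)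
    (h : ∀ n, 1 ≤ n → |Dfun r n x| = |Dfun r n x'|) :
    takagi r x = takagi r x' := by
  have hsq : ∀ n, Dfun r n x ^ 2 = Dfun r n x' ^ 2 := by
    intro n
    rcases Nat.eq_zero_or_pos n with rfl | hn
    · simp [Dfun]
    · exact sq_eq_sq_iff_abs_eq_abs _ _ |>.mpr (h n hn)
  have hlim (y : ℝ) := (summable_takagi r hr y).hasSum.tendsto_sum_nat.add
    (tendsto_takagiRemainder r hr y)
  simp only [sum_takagi_add_takagiRemainder r hr, add_zero] at hlim
  have hlim' := hlim x
  simp only [hsq] at hlim'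
  exact tendsto_nhds_unique hlim' (hlim x')
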